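/- arXiv:2411.08484 — 4 statements merged into one kernel-verified Lean document; each statement's English description precedes it below -/
import Mathlib

section
/- For every real number a > 0 that is not an odd integer multiple of π, the integral ∫₁^∞ 1/((a² + (ln x)²)(1 + x)) dx equals π/(4a) + 2 · Σ_{k=0}^∞ (ln a − ln π − ln(2k+1)) / (a² − (2k+1)²π²). -/
open Real MeasureTheory

open Filter Topology Set

/-- The Mittag-Leffler expansion of the hyperbolic cotangent. -/
theorem hasSum_pi_mul_coth_sub_inv {s : ℝ} (hs : 0 < s) :
    HasSum (fun n : ℕ => 2 * s / (s ^ 2 + (n + 1) ^ 2))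
      (π * (cosh (π * s) / sinh (π * s)) - 1 / s) := by
  have hx : (s * Complex.I : ℂ) ∈ Complex.integerComplement := by
    rintro ⟨m, hm⟩
    have := congrArg Complex.im hm
    simp at this
    exact hs.ne this
  have hsinh : (Complex.sinh (π * s) : ℂ) ≠ 0 := by
    rw [← Complex.ofReal_mul, ← Complex.ofReal_sinh]
    exact_mod_cast (sinh_pos_iff.mpr (mul_pos pi_pos hs)).ne'
  have hsC : (s : ℂ) ≠ 0 := by exact_mod_cast hs.ne'
  have key := ((summable_cotTerm hx).hasSum.mul_left Complex.I)
  have hval : ∑' n, cotTerm (s * Complex.I) n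
      = π * Complex.cot (π * (s * Complex.I)) - 1 / (s * Complex.I) := by
    rw [cot_series_rep' hx]
  rw [hval, Complex.cot_eq_cos_div_sin, ← mul_assoc, Complex.cos_mul_I, Complex.sin_mul_I] at key
  rw [← Complex.hasSum_ofReal]
  convert key using 1
  · rfl
  · funext n
    have h1 : (s * Complex.I - (n + 1) : ℂ) ≠ 0 := fun h => by
      have := congrArg Complex.im h
      simp at this
      exact hs.ne' this
    have h2 : (s * Complex.I + (n + 1) : ℂ) ≠ 0 := fun h => by
      have := congrArg Complex.im h
      simp at this
      exact hs.ne' this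
    have h3 : (s ^ 2 + (n + 1) ^ 2 : ℂ) ≠ 0 := by
      have : (s ^ 2 + (n + 1) ^ 2 : ℝ) ≠ 0 := by positivity
      exact_mod_cast this
    simp only [cotTerm]
    push_cast
    field_simp
    linear_combination (-2 * s * (n + 1) ^ 2 : ℂ) * Complex.I_sq
  · push_cast
    field_simp

/-- The partial fraction expansion of the logistic function. -/
theorem hasSum_logistic {t : ℝ} (ht : 0 < t) :
    HasSum (fun k : ℕ => 2 * t / (t ^ 2 + (2 * k + 1) ^ 2 * π ^ 2))
      (1 / (1 + exp (-t)) - 1 / 2) := by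
  have hpi := pi_pos
  set f : ℕ → ℝ := fun n => 2 * t / (t ^ 2 + (n + 1) ^ 2 * π ^ 2) with hf
  have hall : HasSum f (cosh t / sinh t - 1 / t) := by
    convert (hasSum_pi_mul_coth_sub_inv (div_pos ht hpi)).mul_left (1 / π) using 1
    · rfl
    · funext n
      simp only [hf]
      field_simp
    · rw [mul_div_cancel₀ _ hpi.ne']
      field_simp
  have hodd : HasSum (fun k : ℕ => f (2 * k + 1))
      ((cosh (t / 2) / sinh (t / 2) - 2 / t) / 2) := by
    convert (hasSum_pi_mul_coth_sub_inv (div_pos ht (mul_pos two_pos hpi))).mul_left (1 / (2 * π))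
      using 1
    · rfl
    · funext n
      simp only [hf]
      push_cast
      field_simp
      ring
    · rw [show π * (t / (2 * π)) = t / 2 by field_simp]
      field_simp
  have heven : Summable fun k : ℕ => f (2 * k) :=
    hall.summable.comp_injective (mul_right_injective₀ two_ne_zero)
  have hsum := (heven.hasSum.even_add_odd hodd).unique hall
  convert heven.hasSum using 1
  · funext k
    simp [hf]
  · rw [eq_sub_of_add_eq hsum]
    have h1 : 0 < exp (t / 2) := exp_pos _
    have h2 : 1 < exp (t / 2) := one_lt_exp_iff.mpr (by positivity)
    have e1 : exp t = exp (t / 2) ^ 2 := by rw [← exp_nat_mul]; congr 1; push_cast; ring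
    have h3 : exp (t / 2) ^ 2 - 1 ≠ 0 := by nlinarith
    have h4 : exp (t / 2) ^ 4 - 1 ≠ 0 := by nlinarith [sq_nonneg (exp (t / 2) ^ 2 - 1)]
    simp only [cosh_eq, sinh_eq, exp_neg, e1]
    generalize exp (t / 2) = u at *
    have h5 : (u ^ 2 - (u ^ 2)⁻¹) = (u ^ 4 - 1) / u ^ 2 := by field_simp
    have h6 : u - u⁻¹ = (u ^ 2 - 1) / u := by field_simp
    have h7 : u ^ 4 - 1 = (u ^ 2 - 1) * (u ^ 2 + 1) := by ring
    rw [h5, h6, h7]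
    field_simp
    ring

theorem hasDerivAt_log_sq_add_sub_log_sq_add {a b : ℝ} (ha : 0 < a) (hb : 0 < b) (hab : a ≠ b)
    (t : ℝ) :
    HasDerivAt (fun t => (Real.log (b ^ 2 + t ^ 2) - Real.log (a ^ 2 + t ^ 2)) / (a ^ 2 - b ^ 2))
      (2 * t / ((a ^ 2 + t ^ 2) * (t ^ 2 + b ^ 2))) t := by
  have hd : ∀ c : ℝ, HasDerivAt (fun t : ℝ => c ^ 2 + t ^ 2) (2 * t) t := fun c => by
    simpa using (hasDerivAt_pow 2 t).const_add (c ^ 2)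
  have hne : a ^ 2 - b ^ 2 ≠ 0 := by
    rw [sq_sub_sq]
    exact mul_ne_zero (by positivity) (sub_ne_zero.mpr hab)
  refine ((((hd b).log (by positivity)).sub ((hd a).log (by positivity))).div_const
    (a ^ 2 - b ^ 2)).congr_deriv ?_
  have h1 : a ^ 2 + t ^ 2 ≠ 0 := by positivity
  have h2 : b ^ 2 + t ^ 2 ≠ 0 := by positivity
  rw [add_comm (t ^ 2) (b ^ 2)]
  field_simp
  ring

theorem tendsto_log_sq_add_sub_log_sq_add {a b : ℝ} (ha : 0 < a) (hb : 0 < b) :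
    Tendsto (fun t => (Real.log (b ^ 2 + t ^ 2) - Real.log (a ^ 2 + t ^ 2)) / (a ^ 2 - b ^ 2))
      atTop (𝓝 0) := by
  have hsq : Tendsto (fun t : ℝ => a ^ 2 + t ^ 2) atTop atTop :=
    tendsto_atTop_add_const_left _ _ (tendsto_pow_atTop two_ne_zero)
  have hq : Tendsto (fun t : ℝ => 1 + (b ^ 2 - a ^ 2) / (a ^ 2 + t ^ 2)) atTop (𝓝 1) := by
    simpa using (hsq.const_div_atTop (b ^ 2 - a ^ 2)).const_add 1
  have hl := ((continuousAt_log one_ne_zero).tendsto.comp hq).div_const (a ^ 2 - b ^ 2)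
  rw [Real.log_one, zero_div] at hl
  refine hl.congr fun t => ?_
  have h1 : a ^ 2 + t ^ 2 ≠ 0 := by positivity
  have h2 : b ^ 2 + t ^ 2 ≠ 0 := by positivity
  rw [Function.comp_apply, ← Real.log_div h2 h1]
  congr 2
  field_simp
  ring

theorem integrableOn_two_mul_div_sq_add_mul_sq_add {a b : ℝ} (ha : 0 < a) (hb : 0 < b)
    (hab : a ≠ b) :
    IntegrableOn (fun t : ℝ => 2 * t / ((a ^ 2 + t ^ 2) * (t ^ 2 + b ^ 2))) (Ioi 0) :=
  integrableOn_Ioi_deriv_of_nonneg'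
    (fun t _ => hasDerivAt_log_sq_add_sub_log_sq_add ha hb hab t)
    (fun t ht => by have : 0 < t := ht; positivity)
    (tendsto_log_sq_add_sub_log_sq_add ha hb)

theorem integral_two_mul_div_sq_add_mul_sq_add {a b : ℝ} (ha : 0 < a) (hb : 0 < b)
    (hab : a ≠ b) :
    ∫ t in Ioi (0 : ℝ), 2 * t / ((a ^ 2 + t ^ 2) * (t ^ 2 + b ^ 2)) =
      2 * ((Real.log a - Real.log b) / (a ^ 2 - b ^ 2)) := by
  rw [integral_Ioi_of_hasDerivAt_of_nonneg'
    (fun t _ => hasDerivAt_log_sq_add_sub_log_sq_add ha hb hab t)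
    (fun t ht => by have : 0 < t := ht; positivity)
    (tendsto_log_sq_add_sub_log_sq_add ha hb)]
  simp only [ne_eq, OfNat.ofNat_ne_zero, not_false_eq_true, zero_pow, add_zero, Real.log_pow]
  push_cast
  ring

theorem hasDerivAt_arctan_div_div {a : ℝ} (ha : 0 < a) (t : ℝ) :
    HasDerivAt (fun t => arctan (t / a) / a) (1 / (a ^ 2 + t ^ 2)) t := by
  refine ((((hasDerivAt_id t).div_const a).arctan).div_const a).congr_deriv ?_
  simp only [id]
  field_simp

theorem tendsto_arctan_div_div {a : ℝ} (ha : 0 < a) :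
    Tendsto (fun t => arctan (t / a) / a) atTop (𝓝 (π / 2 / a)) :=
  ((tendsto_arctan_atTop.mono_right nhdsWithin_le_nhds).comp
    (tendsto_id.atTop_div_const ha)).div_const a

theorem integrableOn_one_div_sq_add_sq {a : ℝ} (ha : 0 < a) :
    IntegrableOn (fun t : ℝ => 1 / (a ^ 2 + t ^ 2)) (Ioi 0) :=
  integrableOn_Ioi_deriv_of_nonneg' (fun t _ => hasDerivAt_arctan_div_div ha t)
    (fun t _ => by positivity) (tendsto_arctan_div_div ha)

theorem integral_one_div_sq_add_sq {a : ℝ} (ha : 0 < a) :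
    ∫ t in Ioi (0 : ℝ), 1 / (a ^ 2 + t ^ 2) = π / (2 * a) := by
  rw [integral_Ioi_of_hasDerivAt_of_nonneg' (fun t _ => hasDerivAt_arctan_div_div ha t)
    (fun t _ => by positivity) (tendsto_arctan_div_div ha)]
  simp [div_div]

theorem image_exp_Ioi_zero : exp '' Ioi 0 = Ioi 1 := by
  ext x
  constructor
  · rintro ⟨t, ht, rfl⟩
    exact one_lt_exp_iff.mpr ht
  · intro hx
    exact ⟨Real.log x, Real.log_pos hx, exp_log (one_pos.trans hx)⟩

theorem integral_Ioi_one_eq_integral_logistic (a : ℝ) :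
    ∫ x in Ioi (1 : ℝ), 1 / ((a ^ 2 + Real.log x ^ 2) * (1 + x)) =
      ∫ t in Ioi (0 : ℝ), 1 / (a ^ 2 + t ^ 2) * (1 / (1 + exp (-t))) := by
  rw [← image_exp_Ioi_zero, integral_image_eq_integral_abs_deriv_smul measurableSet_Ioi
    (fun t _ => (hasDerivAt_exp t).hasDerivWithinAt) exp_injective.injOn]
  refine integral_congr_ae (Eventually.of_forall fun t => ?_)
  have h := exp_pos t
  simp only [smul_eq_mul, abs_of_pos h, Real.log_exp, exp_neg]
  rw [one_div_mul_one_div, mul_one_div]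
  have h1 : 1 + (exp t)⁻¹ = (1 + exp t) / exp t := by field_simp; ring
  rw [h1, mul_div_assoc', one_div_div]

theorem bdh_integral_four (a : ℝ) (ha : 0 < a)
    (hodd : ∀ n : ℤ, a ≠ (2 * n + 1) * π) :
    (∫ x in Set.Ioi (1:ℝ), 1 / ((a ^ 2 + Real.log x ^ 2) * (1 + x))) =
      π / (4 * a) +
        2 * ∑' k : ℕ,
          (Real.log a - Real.log π - Real.log (2 * k + 1)) /
            (a ^ 2 - (2 * k + 1) ^ 2 * π ^ 2) := by
  have hpi := pi_pos
  set F : ℕ → ℝ → ℝ := fun k t =>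
    2 * t / ((a ^ 2 + t ^ 2) * (t ^ 2 + ((2 * k + 1) * π) ^ 2)) with hF
  have hb : ∀ k : ℕ, 0 < (2 * (k : ℝ) + 1) * π := fun k => by positivity
  have hab : ∀ k : ℕ, a ≠ (2 * (k : ℝ) + 1) * π := fun k => by exact_mod_cast hodd k
  have hFint : ∀ k, IntegrableOn (F k) (Ioi 0) := fun k =>
    integrableOn_two_mul_div_sq_add_mul_sq_add ha (hb k) (hab k)
  have hF0 : ∀ k, ∀ t ∈ Ioi (0 : ℝ), 0 ≤ F k t := fun k t ht => by
    have : 0 < t := ht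
    positivity
  have hFsum : ∀ t ∈ Ioi (0 : ℝ), HasSum (fun k => F k t)
      (1 / (a ^ 2 + t ^ 2) * (1 / (1 + exp (-t)) - 1 / 2)) := fun t ht => by
    convert (hasSum_logistic ht).mul_left (1 / (a ^ 2 + t ^ 2)) using 1
    · rfl
    · funext k
      simp only [hF]
      rw [div_mul_div_comm, one_mul, mul_pow]
  have hlog : ∀ t : ℝ, 1 / (1 + exp (-t)) ≤ 1 := fun t => by
    rw [div_le_one (by positivity)]
    linarith [exp_pos (-t)]
  have hcauchy := integrableOn_one_div_sq_add_sq ha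
  have hnorm : ∀ k, ∫ t in Ioi (0 : ℝ), ‖F k t‖ = ∫ t in Ioi (0 : ℝ), F k t := fun k =>
    setIntegral_congr_fun measurableSet_Ioi fun t ht => norm_of_nonneg (hF0 k t ht)
  have hsummable : Summable fun k => ∫ t in Ioi (0 : ℝ), ‖F k t‖ := by
    simp_rw [hnorm]
    refine summable_of_sum_le (c := ∫ t in Ioi (0 : ℝ), 1 / (a ^ 2 + t ^ 2))
      (fun k => setIntegral_nonneg measurableSet_Ioi (hF0 k)) fun u => ?_
    rw [← integral_finsetSum u fun k _ => hFint k]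
    refine setIntegral_mono_on (integrable_finsetSum u fun k _ => hFint k) hcauchy
      measurableSet_Ioi fun t ht => ?_
    refine (sum_le_hasSum u (fun k _ => hF0 k t ht) (hFsum t ht)).trans ?_
    exact mul_le_of_le_one_right (by positivity) (by linarith [hlog t])
  have htsum := (hasSum_integral_of_summable_integral_norm hFint hsummable).tsum_eq
  rw [setIntegral_congr_fun measurableSet_Ioi fun t ht => (hFsum t ht).tsum_eq] at htsum
  have hlogint : IntegrableOn (fun t : ℝ => 1 / (a ^ 2 + t ^ 2) * (1 / (1 + exp (-t))))
      (Ioi 0) := by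
    refine hcauchy.mono' ?_ (Eventually.of_forall fun t => ?_)
    · exact Measurable.aestronglyMeasurable (by fun_prop)
    · rw [norm_of_nonneg (by positivity)]
      exact mul_le_of_le_one_right (by positivity) (hlog t)
  simp_rw [mul_sub] at htsum
  rw [integral_sub hlogint (hcauchy.mul_const _), integral_mul_const,
    integral_one_div_sq_add_sq ha] at htsum
  rw [integral_Ioi_one_eq_integral_logistic, ← tsum_mul_left]
  have hterm : ∀ k : ℕ, ∫ t in Ioi (0 : ℝ), F k t =
      2 * ((Real.log a - Real.log π - Real.log (2 * k + 1)) /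
        (a ^ 2 - (2 * k + 1) ^ 2 * π ^ 2)) := fun k => by
    rw [integral_two_mul_div_sq_add_mul_sq_add ha (hb k) (hab k),
      Real.log_mul (by positivity) hpi.ne', mul_pow, add_comm (Real.log (2 * k + 1)), ← sub_sub]
  simp_rw [hterm] at htsum
  rw [htsum]
  field_simp
  ring
end

section
/- The integral ∫₀¹ 1/((π² + (ln x)²)(1 + x)) dx equals 1/4 − 1/π² − (1/(2π²)) · Σ_{k=1}^∞ ln(2k+1)/(k(k+1)). -/
open Real MeasureTheory

open Filter Topology Set in
lemma hasSum_coth_sub_inv {s : ℝ} (hs : 0 < s) :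
    HasSum (fun n : ℕ => 2 * s / (s ^ 2 + (n + 1) ^ 2 * π ^ 2))
      ((exp (2 * s) + 1) / (exp (2 * s) - 1) - 1 / s) := by
  have hpi : (π : ℂ) ≠ 0 := by exact_mod_cast pi_ne_zero
  have hsC : (s : ℂ) ≠ 0 := by exact_mod_cast hs.ne'
  set x : ℂ := -Complex.I * s / π with hx
  have hx_mem : x ∈ Complex.integerComplement := by
    rintro ⟨m, hm⟩
    have him : x.im = -(s / π) := by
      have : x = ((-(s / π) : ℝ) : ℂ) * Complex.I := by
        rw [hx]; push_cast; ring
      rw [this, Complex.im_ofReal_mul]; simp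
    rw [← hm, Complex.intCast_im] at him
    have := div_pos hs pi_pos
    linarith
  have hexp : Complex.exp (2 * Complex.I * (π * x)) = ((exp (2 * s) : ℝ) : ℂ) := by
    rw [Complex.ofReal_exp]
    congr 1
    rw [hx]
    push_cast
    field_simp
    rw [Complex.I_sq]
    ring
  have hE : (1 : ℝ) < exp (2 * s) := one_lt_exp_iff.mpr (by positivity)
  have hE' : ((exp (2 * s) : ℝ) : ℂ) - 1 ≠ 0 := by
    exact_mod_cast (sub_pos.mpr hE).ne'
  have hE'' : 1 - ((exp (2 * s) : ℝ) : ℂ) ≠ 0 := by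
    rw [← neg_sub]; exact neg_ne_zero.mpr hE'
  have hterm (n : ℕ) : cotTerm x n =
      π * Complex.I * ((2 * s / (s ^ 2 + (n + 1) ^ 2 * π ^ 2) : ℝ) : ℂ) := by
    have hden : ((s : ℂ) ^ 2 + (n + 1) ^ 2 * π ^ 2) ≠ 0 := by
      have : s ^ 2 + ((n : ℝ) + 1) ^ 2 * π ^ 2 ≠ 0 := by positivity
      exact_mod_cast this
    have h1 : x - (n + 1) ≠ 0 := by
      simpa [sub_eq_add_neg, add_comm] using
        Complex.integerComplement_add_ne_zero hx_mem (-(n + 1 : ℤ))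
    have h2 : x + (n + 1) ≠ 0 := by
      simpa using Complex.integerComplement_add_ne_zero hx_mem (n + 1 : ℤ)
    have hxx : (π : ℂ) * x = -Complex.I * s := by rw [hx]; field_simp
    have hprod : (π : ℂ) ^ 2 * ((x - (n + 1)) * (x + (n + 1))) =
        -((s : ℂ) ^ 2 + (n + 1) ^ 2 * π ^ 2) := by
      linear_combination (π * x - Complex.I * s) * hxx + s ^ 2 * Complex.I_sq
    have hsum : cotTerm x n = 2 * x / ((x - (n + 1)) * (x + (n + 1))) := by
      rw [cotTerm]; field_simp; ring
    rw [hsum, ← mul_div_mul_left _ _ (pow_ne_zero 2 hpi), hprod]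
    push_cast
    have hnum : (π : ℂ) ^ 2 * (2 * x) = -(π * Complex.I * (2 * s)) := by
      linear_combination 2 * π * hxx
    rw [hnum, neg_div_neg_eq, mul_div_assoc]
  have hH : HasSum (cotTerm x) (π * Complex.cot (π * x) - 1 / x) := by
    rw [cot_series_rep' hx_mem]; exact (summable_cotTerm hx_mem).hasSum
  have hval : π * Complex.cot (π * x) - 1 / x = π * Complex.I *
      (((exp (2 * s) + 1) / (exp (2 * s) - 1) - 1 / s : ℝ) : ℂ) := by
    rw [Complex.cot_eq_exp_ratio, hexp, hx]
    push_cast at hE' hE'' ⊢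
    field_simp
    linear_combination (s * Complex.exp (2 * s) ^ 2 - s - (Complex.exp (2 * s) - 1) ^ 2) *
      Complex.I_sq
  have hpiI : (π : ℂ) * Complex.I ≠ 0 := mul_ne_zero hpi Complex.I_ne_zero
  rw [hval, funext hterm, hasSum_mul_left_iff hpiI] at hH
  exact_mod_cast hH

lemma hasSum_tanh_half {t : ℝ} (ht : 0 < t) :
    HasSum (fun k : ℕ => 4 * t / (t ^ 2 + (2 * k + 1) ^ 2 * π ^ 2))
      (1 - 2 / (exp t + 1)) := by
  have hfull := (hasSum_coth_sub_inv ht).mul_left 2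
  have hhalf := hasSum_coth_sub_inv (half_pos ht)
  have heven : Summable fun k : ℕ => 4 * t / (t ^ 2 + (2 * k + 1) ^ 2 * π ^ 2) := by
    refine (hfull.summable.comp_injective
      (mul_right_injective₀ (two_ne_zero (α := ℕ)))).congr fun k => ?_
    simp only [Function.comp_apply]
    push_cast
    ring
  have hodd : HasSum (fun k : ℕ => 2 * (2 * t / (t ^ 2 + (((2 * k + 1 : ℕ) : ℝ) + 1) ^ 2 * π ^ 2)))
      ((exp (2 * (t / 2)) + 1) / (exp (2 * (t / 2)) - 1) - 1 / (t / 2)) := by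
    refine hhalf.congr_fun fun k => ?_
    push_cast
    field_simp
    ring
  have heven' : HasSum (fun k : ℕ => 2 * (2 * t / (t ^ 2 + (((2 * k : ℕ) : ℝ) + 1) ^ 2 * π ^ 2)))
      (∑' k : ℕ, 4 * t / (t ^ 2 + (2 * k + 1) ^ 2 * π ^ 2)) := by
    refine heven.hasSum.congr_fun fun k => ?_
    push_cast
    ring
  have huniq := (HasSum.even_add_odd (f := fun n : ℕ =>
    2 * (2 * t / (t ^ 2 + ((n : ℝ) + 1) ^ 2 * π ^ 2))) heven' hodd).unique hfull
  convert heven.hasSum using 1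
  rw [eq_sub_of_add_eq huniq, mul_div_cancel₀ t two_ne_zero, two_mul t, exp_add]
  have hE : exp t - 1 ≠ 0 := (sub_pos.mpr (one_lt_exp_iff.mpr ht)).ne'
  have hE1 : exp t + 1 ≠ 0 := by positivity
  rw [show exp t * exp t - 1 = (exp t - 1) * (exp t + 1) by ring]
  field_simp
  ring

open Filter Topology Set in
lemma integral_Ioi_two_mul_div_mul {a b : ℝ} (ha : 0 < a) (hab : a < b) :
    ∫ t in Ioi (0 : ℝ), 2 * t / ((a ^ 2 + t ^ 2) * (t ^ 2 + b ^ 2)) =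
      2 * log (b / a) / (b ^ 2 - a ^ 2) := by
  have hb : 0 < b := ha.trans hab
  have hd : 0 < b ^ 2 - a ^ 2 := by nlinarith
  have hlim : Tendsto (fun t : ℝ => log ((t ^ 2 + a ^ 2) / (t ^ 2 + b ^ 2)) / (b ^ 2 - a ^ 2))
      atTop (𝓝 0) := by
    have h1 : Tendsto (fun t : ℝ => t ^ 2 + b ^ 2) atTop atTop :=
      tendsto_atTop_add_const_right _ _ (tendsto_pow_atTop two_ne_zero)
    have h2 : Tendsto (fun t : ℝ => 1 - (b ^ 2 - a ^ 2) / (t ^ 2 + b ^ 2)) atTop (𝓝 (1 - 0)) :=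
      (h1.const_div_atTop _).const_sub 1
    rw [sub_zero] at h2
    have h3 := (h2.log one_ne_zero).div_const (b ^ 2 - a ^ 2)
    rw [log_one, zero_div] at h3
    refine h3.congr fun t => ?_
    congr 2
    field_simp
    ring
  rw [integral_Ioi_of_hasDerivAt_of_nonneg' (fun t _ => ?_) (fun t ht => ?_) hlim]
  · have : log ((0 ^ 2 + a ^ 2) / (0 ^ 2 + b ^ 2)) = -(2 * log (b / a)) := by
      rw [log_div (by positivity) (by positivity), log_div hb.ne' ha.ne']
      simp only [ne_eq, OfNat.ofNat_ne_zero, not_false_eq_true, zero_pow, zero_add, log_pow]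
      push_cast
      ring
    rw [this]
    ring
  · have hA : HasDerivAt (fun t : ℝ => t ^ 2 + a ^ 2) (2 * t) t := by
      simpa using (hasDerivAt_pow 2 t).add_const (a ^ 2)
    have hB : HasDerivAt (fun t : ℝ => t ^ 2 + b ^ 2) (2 * t) t := by
      simpa using (hasDerivAt_pow 2 t).add_const (b ^ 2)
    have hA0 : t ^ 2 + a ^ 2 ≠ 0 := by positivity
    have hB0 : t ^ 2 + b ^ 2 ≠ 0 := by positivity
    have hA1 : a ^ 2 + t ^ 2 ≠ 0 := by positivity
    refine (((hA.div hB hB0).log (div_ne_zero hA0 hB0)).div_const _).congr_deriv ?_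
    simp only [Pi.div_apply]
    field_simp
    ring
  · have : 0 < t := ht
    positivity

open Filter Topology Set in
lemma integral_Ioi_two_mul_div_sq {a : ℝ} (ha : 0 < a) :
    ∫ t in Ioi (0 : ℝ), 2 * t / ((a ^ 2 + t ^ 2) * (t ^ 2 + a ^ 2)) = 1 / a ^ 2 := by
  have hlim : Tendsto (fun t : ℝ => -1 / (t ^ 2 + a ^ 2)) atTop (𝓝 0) :=
    (tendsto_atTop_add_const_right _ _ (tendsto_pow_atTop two_ne_zero)).const_div_atTop _
  rw [integral_Ioi_of_hasDerivAt_of_nonneg' (fun t _ => ?_) (fun t ht => ?_) hlim]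
  · ring
  · have hA : HasDerivAt (fun t : ℝ => t ^ 2 + a ^ 2) (2 * t) t := by
      simpa using (hasDerivAt_pow 2 t).add_const (a ^ 2)
    have hA0 : t ^ 2 + a ^ 2 ≠ 0 := by positivity
    have hA1 : a ^ 2 + t ^ 2 ≠ 0 := by positivity
    refine ((hasDerivAt_const t (-1 : ℝ)).div hA hA0).congr_deriv ?_
    field_simp
    ring
  · have : 0 < t := ht
    positivity

open Filter Topology Set in
lemma integrableOn_and_integral_Ioi_inv_sq_add_sq {a : ℝ} (ha : 0 < a) :
    IntegrableOn (fun t : ℝ => 1 / (a ^ 2 + t ^ 2)) (Ioi 0) ∧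
      ∫ t in Ioi (0 : ℝ), 1 / (a ^ 2 + t ^ 2) = π / (2 * a) := by
  have hlim : Tendsto (fun t : ℝ => arctan (t / a) / a) atTop (𝓝 (π / 2 / a)) :=
    ((tendsto_arctan_atTop.mono_right nhdsWithin_le_nhds).comp
      (tendsto_id.atTop_div_const ha)).div_const a
  have hderiv (t : ℝ) : HasDerivAt (fun t : ℝ => arctan (t / a) / a) (1 / (a ^ 2 + t ^ 2)) t := by
    refine ((((hasDerivAt_id t).div_const a).arctan).div_const a).congr_deriv ?_
    simp only [id]
    field_simp
  have hpos : ∀ t ∈ Ioi (0 : ℝ), 0 ≤ 1 / (a ^ 2 + t ^ 2) := fun t _ => by positivity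
  refine ⟨integrableOn_Ioi_deriv_of_nonneg' (fun t _ => hderiv t) hpos hlim, ?_⟩
  rw [integral_Ioi_of_hasDerivAt_of_nonneg' (fun t _ => hderiv t) hpos hlim]
  simp only [zero_div, arctan_zero, sub_zero]
  field_simp

open Set in
lemma integral_zero_one_eq_integral_Ioi_exp_neg (g : ℝ → ℝ) :
    ∫ x in (0 : ℝ)..1, g x = ∫ t in Ioi (0 : ℝ), exp (-t) * g (exp (-t)) := by
  have himage : (fun t : ℝ => exp (-t)) '' Ioi 0 = Ioo 0 1 := by
    ext y
    constructor
    · rintro ⟨t, ht, rfl⟩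
      exact ⟨exp_pos _, by simpa using ht⟩
    · rintro ⟨h0, h1⟩
      refine ⟨-log y, neg_pos.mpr (log_neg h0 h1), ?_⟩
      simp only [neg_neg, exp_log h0]
  rw [intervalIntegral.integral_of_le zero_le_one, integral_Ioc_eq_integral_Ioo, ← himage,
    integral_image_eq_integral_abs_deriv_smul measurableSet_Ioi
      (fun t _ => ((hasDerivAt_neg t).exp).hasDerivWithinAt)
      (fun s _ t _ h => neg_injective (exp_injective h))]
  simp

open Set in
lemma hasSum_integral_Ioi_tanh :
    HasSum (fun k : ℕ => ∫ t in Ioi (0 : ℝ),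
        2 * t / ((π ^ 2 + t ^ 2) * (t ^ 2 + ((2 * k + 1) * π) ^ 2)))
      (1 / 4 - ∫ t in Ioi (0 : ℝ), 1 / ((π ^ 2 + t ^ 2) * (exp t + 1))) := by
  obtain ⟨hint, hval⟩ := integrableOn_and_integral_Ioi_inv_sq_add_sq pi_pos
  have hint' : IntegrableOn (fun t : ℝ => 1 / ((π ^ 2 + t ^ 2) * (exp t + 1))) (Ioi 0) := by
    refine hint.mono' (Measurable.aestronglyMeasurable (by fun_prop)) (Filter.Eventually.of_forall fun t => ?_)
    rw [norm_of_nonneg (by positivity)]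
    gcongr
    exact le_mul_of_one_le_right (by positivity) (by linarith [exp_pos t])
  have hsum : ∀ t ∈ Ioi (0 : ℝ), HasSum (fun k : ℕ =>
      2 * t / ((π ^ 2 + t ^ 2) * (t ^ 2 + ((2 * k + 1) * π) ^ 2)))
      (1 / 2 * (1 / (π ^ 2 + t ^ 2)) - 1 / ((π ^ 2 + t ^ 2) * (exp t + 1))) := by
    intro t ht
    have hpos : π ^ 2 + t ^ 2 ≠ 0 := by positivity
    have hlim : 1 / 2 * (1 / (π ^ 2 + t ^ 2)) - 1 / ((π ^ 2 + t ^ 2) * (exp t + 1)) =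
        1 / (2 * (π ^ 2 + t ^ 2)) * (1 - 2 / (exp t + 1)) := by
      have : exp t + 1 ≠ 0 := by positivity
      field_simp
    rw [hlim]
    refine ((hasSum_tanh_half ht).mul_left (1 / (2 * (π ^ 2 + t ^ 2)))).congr_fun fun k => ?_
    field_simp
    ring
  have hlim_int := (hint.const_mul (1 / 2)).sub hint'
  have key := hasSum_integral_of_dominated_convergence (μ := volume.restrict (Ioi (0 : ℝ)))
    (F := fun (k : ℕ) t => 2 * t / ((π ^ 2 + t ^ 2) * (t ^ 2 + ((2 * k + 1) * π) ^ 2)))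
    (f := fun t => 1 / 2 * (1 / (π ^ 2 + t ^ 2)) - 1 / ((π ^ 2 + t ^ 2) * (exp t + 1)))
    (fun k t => 2 * t / ((π ^ 2 + t ^ 2) * (t ^ 2 + ((2 * k + 1) * π) ^ 2)))
    (fun k => Measurable.aestronglyMeasurable (by fun_prop))
    (fun k => (ae_restrict_mem measurableSet_Ioi).mono fun t (ht : 0 < t) =>
      (norm_of_nonneg (by positivity)).le)
    ((ae_restrict_mem measurableSet_Ioi).mono fun t ht => (hsum t ht).summable)
    (hlim_int.congr <| (ae_restrict_mem measurableSet_Ioi).mono fun t ht =>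
      (hsum t ht).tsum_eq.symm)
    ((ae_restrict_mem measurableSet_Ioi).mono hsum)
  rw [integral_sub (hint.const_mul _) hint', integral_const_mul, hval,
    show 1 / 2 * (π / (2 * π)) = 1 / 4 by field_simp; norm_num] at key
  exact key

theorem bdh_integral_six :
    (∫ x in (0:ℝ)..1, 1 / ((π ^ 2 + Real.log x ^ 2) * (1 + x))) =
      1 / 4 - 1 / π ^ 2 -
        (1 / (2 * π ^ 2)) *
          ∑' k : ℕ, Real.log (2 * (k + 1) + 1) / ((k + 1) * ((k + 1) + 1)) := by
  have hsubst : (∫ x in (0:ℝ)..1, 1 / ((π ^ 2 + Real.log x ^ 2) * (1 + x))) =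
      ∫ t in Set.Ioi (0 : ℝ), 1 / ((π ^ 2 + t ^ 2) * (exp t + 1)) := by
    rw [integral_zero_one_eq_integral_Ioi_exp_neg]
    congr 1
    funext t
    rw [log_exp, exp_neg]
    field_simp
  have hsum := hasSum_integral_Ioi_tanh
  have hsplit := hsum.summable.tsum_eq_zero_add
  have hterm (k : ℕ) : ∫ t in Set.Ioi (0 : ℝ),
      2 * t / ((π ^ 2 + t ^ 2) * (t ^ 2 + ((2 * ((k + 1 : ℕ) : ℝ) + 1) * π) ^ 2)) =
      1 / (2 * π ^ 2) * (Real.log (2 * (k + 1) + 1) / ((k + 1) * ((k + 1) + 1))) := by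
    rw [integral_Ioi_two_mul_div_mul pi_pos
      (lt_mul_of_one_lt_left pi_pos (by push_cast; linarith [k.cast_nonneg (α := ℝ)])),
      mul_div_cancel_right₀ _ pi_ne_zero]
    have hden : ((2 * ((k + 1 : ℕ) : ℝ) + 1) * π) ^ 2 - π ^ 2 =
        4 * π ^ 2 * ((k + 1) * ((k + 1) + 1)) := by
      push_cast; ring
    rw [hden]
    push_cast
    field_simp
    ring
  have hzero : ∫ t in Set.Ioi (0 : ℝ),
      2 * t / ((π ^ 2 + t ^ 2) * (t ^ 2 + ((2 * ((0 : ℕ) : ℝ) + 1) * π) ^ 2)) = 1 / π ^ 2 := by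
    simpa using integral_Ioi_two_mul_div_sq pi_pos
  rw [hsum.tsum_eq, hzero, tsum_congr hterm, tsum_mul_left] at hsplit
  rw [hsubst]
  linarith
end

section
/- For every real number a > 0, the integral ∫₀¹ 1/((a² + (ln x)²)(1 + x)²) dx equals −(1/(4aπ))·ψ⁽¹⁾(a/(2π)) + (1/(aπ))·ψ⁽¹⁾(a/π). -/
open Real MeasureTheory

/-- The digamma function: the derivative of `log ∘ Γ` on the positive reals. -/
noncomputable def digamma (x : ℝ) : ℝ := deriv (fun y => Real.log (Real.Gamma y)) x

/-- The trigamma function `ψ⁽¹⁾`: the second derivative of `log ∘ Γ` on the positive reals. -/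
noncomputable def trigamma (x : ℝ) : ℝ :=
  deriv (deriv (fun y => Real.log (Real.Gamma y))) x

open Filter Set Topology

lemma differentiableAt_log_Gamma {x : ℝ} (hx : 0 < x) :
    DifferentiableAt ℝ (fun y ↦ log (Gamma y)) x :=
  (differentiableAt_Gamma fun m ↦ by
    have : (0 : ℝ) ≤ m := m.cast_nonneg
    linarith).log (Gamma_pos_of_pos hx).ne'

lemma deriv_log_Gamma_add_one {x : ℝ} (hx : 0 < x) :
    deriv (fun y ↦ log (Gamma y)) (x + 1) = deriv (fun y ↦ log (Gamma y)) x + 1 / x := by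
  rw [← deriv_comp_add_const, EventuallyEq.deriv_eq (f := fun y ↦ log (Gamma y) + log y)]
  · rw [deriv_fun_add (differentiableAt_log_Gamma hx) (differentiableAt_log hx.ne'), deriv_log,
      one_div]
  · filter_upwards [eventually_gt_nhds hx] with y hy
    rw [Gamma_add_one hy.ne', log_mul hy.ne' (Gamma_pos_of_pos hy).ne', add_comm]

lemma deriv_log_Gamma_add_nat {x : ℝ} (hx : 0 < x) (n : ℕ) :
    deriv (fun y ↦ log (Gamma y)) (x + n) =
      deriv (fun y ↦ log (Gamma y)) x + ∑ k ∈ Finset.range n, 1 / (x + k) := by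
  induction n with
  | zero => simp
  | succ n ih =>
    rw [Nat.cast_succ, ← add_assoc, deriv_log_Gamma_add_one (by positivity), ih,
      Finset.sum_range_succ, add_assoc]

lemma monotoneOn_deriv_log_Gamma : MonotoneOn (deriv fun y ↦ log (Gamma y)) (Ioi 0) :=
  convexOn_log_Gamma.monotoneOn_deriv fun _ hx ↦ differentiableAt_log_Gamma hx

lemma tendsto_deriv_log_Gamma_add_nat_sub {x y : ℝ} (hx : 0 < x) (hxy : x ≤ y) :
    Tendsto (fun n : ℕ ↦ deriv (fun y ↦ log (Gamma y)) (y + n) -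
      deriv (fun y ↦ log (Gamma y)) (x + n)) atTop (𝓝 0) := by
  have hy : 0 < y := hx.trans_le hxy
  obtain ⟨m, hm⟩ := exists_nat_ge (y - x)
  have hub : Tendsto (fun n : ℕ ↦ ∑ k ∈ Finset.range m, 1 / (x + n + k)) atTop (𝓝 0) := by
    rw [← Finset.sum_const_zero (s := Finset.range m)]
    refine tendsto_finsetSum _ fun k _ ↦ ?_
    simp_rw [one_div]
    exact tendsto_inv_atTop_zero.comp (tendsto_atTop_add_const_right _ _
      (tendsto_atTop_add_const_left _ _ tendsto_natCast_atTop_atTop))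
  refine squeeze_zero (fun n ↦ ?_) (fun n ↦ ?_) hub
  · exact sub_nonneg.mpr (monotoneOn_deriv_log_Gamma (mem_Ioi.mpr (by positivity))
      (mem_Ioi.mpr (by positivity)) (by linarith))
  · have h := deriv_log_Gamma_add_nat (x := x + n) (by positivity) m
    have h' := monotoneOn_deriv_log_Gamma (a := y + n) (b := x + n + m)
      (mem_Ioi.mpr (by positivity)) (mem_Ioi.mpr (by positivity)) (by linarith)
    linarith

lemma summable_one_div_add_sq {x : ℝ} (hx : 0 < x) :
    Summable fun n : ℕ ↦ 1 / (x + n) ^ 2 := by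
  refine (summable_nat_add_iff 1).mp (Summable.of_nonneg_of_le (fun n ↦ by positivity) (fun n ↦ ?_)
    ((summable_nat_add_iff 1).mpr (summable_one_div_nat_pow.mpr one_lt_two)))
  gcongr
  linarith

lemma hasSum_deriv_log_Gamma_sub {x y : ℝ} (hx : 0 < x) (hxy : x ≤ y) :
    HasSum (fun n : ℕ ↦ 1 / (x + n) - 1 / (y + n))
      (deriv (fun y ↦ log (Gamma y)) y - deriv (fun y ↦ log (Gamma y)) x) := by
  rw [hasSum_iff_tendsto_nat_of_nonneg]
  · have h := (tendsto_deriv_log_Gamma_add_nat_sub hx hxy).const_sub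
      (deriv (fun y ↦ log (Gamma y)) y - deriv (fun y ↦ log (Gamma y)) x)
    rw [sub_zero] at h
    refine h.congr fun n ↦ ?_
    rw [deriv_log_Gamma_add_nat hx, deriv_log_Gamma_add_nat (hx.trans_le hxy),
      Finset.sum_sub_distrib]
    ring
  · intro n
    rw [sub_nonneg]
    gcongr

/-- The series expansion `ψ⁽¹⁾(x) = ∑ 1 / (x + n) ^ 2`. -/
lemma hasSum_trigamma {x : ℝ} (hx : 0 < x) :
    HasSum (fun n : ℕ ↦ 1 / (x + n) ^ 2) (trigamma x) := by
  have hc : 0 < x / 2 := half_pos hx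
  have hder : HasDerivAt (fun y ↦ ∑' n : ℕ, (1 / (x / 2 + n) - 1 / (y + n)))
      (∑' n : ℕ, 1 / (x + n) ^ 2) x := by
    refine hasDerivAt_tsum_of_isPreconnected (summable_one_div_add_sq hc) isOpen_Ioi
      isPreconnected_Ioi (t := Ioi (x / 2)) (g := fun (n : ℕ) y ↦ 1 / (x / 2 + n) - 1 / (y + n))
      (g' := fun (n : ℕ) y ↦ 1 / (y + n) ^ 2) (y₀ := x)
      (fun n y hy ↦ ?_) (fun n y hy ↦ ?_) ?_ ?_ ?_
    · have hy' : y + n ≠ 0 := by have : 0 < y := hc.trans hy; positivity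
      have h := (((hasDerivAt_id y).add_const (n : ℝ)).inv hy').const_sub (1 / (x / 2 + n))
      simpa [neg_div] using h
    · have : x / 2 < y := hy
      rw [Real.norm_of_nonneg (by positivity)]
      gcongr
    · exact half_lt_self hx
    · exact (hasSum_deriv_log_Gamma_sub hc (half_le_self hx.le)).summable
    · exact half_lt_self hx
  have heq : deriv (fun y ↦ log (Gamma y)) =ᶠ[𝓝 x] fun y ↦
      deriv (fun y ↦ log (Gamma y)) (x / 2) + ∑' n : ℕ, (1 / (x / 2 + n) - 1 / (y + n)) := by
    filter_upwards [eventually_gt_nhds (half_lt_self hx)] with y hy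
    rw [(hasSum_deriv_log_Gamma_sub hc hy.le).tsum_eq]
    ring
  rw [trigamma, heq.deriv_eq, (hder.const_add _).deriv]
  exact (summable_one_div_add_sq hx).hasSum

/-- The duplication formula for the trigamma function. -/
lemma hasSum_trigamma_duplication {x : ℝ} (hx : 0 < x) :
    HasSum (fun n : ℕ ↦ 1 / (x + 1 / 2 + n) ^ 2) (4 * trigamma (2 * x) - trigamma x) := by
  have h := hasSum_trigamma (x := x + 1 / 2) (by positivity)
  have hev : HasSum (fun k : ℕ ↦ 4 * (1 / (2 * x + (2 * k : ℕ)) ^ 2)) (trigamma x) := by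
    convert hasSum_trigamma hx using 2 with k
    push_cast; field_simp; ring
  have hodd : HasSum (fun k : ℕ ↦ 4 * (1 / (2 * x + (2 * k + 1 : ℕ)) ^ 2))
      (trigamma (x + 1 / 2)) := by
    convert h using 2 with k
    push_cast; field_simp; ring
  have h2 := (hasSum_trigamma (x := 2 * x) (by positivity)).mul_left 4
  rw [h2.unique (hev.even_add_odd hodd), add_sub_cancel_left]
  exact h

/-- The partial fraction expansion of `π ^ 2 / sin (π z) ^ 2` on the upper half plane. -/
lemma hasSum_int_one_div_add_sq {z : ℂ} (hz : 0 < z.im) :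
    HasSum (fun n : ℤ ↦ 1 / (z + n) ^ 2) (π ^ 2 / Complex.sin (π * z) ^ 2) := by
  have hmem : z ∈ UpperHalfPlane.upperHalfPlaneSet := hz
  have hsum : Summable (fun n : ℤ ↦ 1 / (z + n) ^ 2) := by
    simpa using! EisensteinSeries.linear_right_summable z 1 (k := 2) le_rfl
  have hsin : Complex.sin (π * z) ≠ 0 := by
    rw [Complex.sin_ne_zero_iff]
    intro k hk
    have := congrArg Complex.im hk
    simp [hz.ne', pi_ne_zero] at this
  have hder : HasDerivAt (fun x : ℂ ↦ π * Complex.cot (π * x))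
      (-(π ^ 2 / Complex.sin (π * z) ^ 2)) z := by
    have hlin : HasDerivAt (fun x : ℂ ↦ π * x) π z := by
      simpa using (hasDerivAt_id z).const_mul (π : ℂ)
    have h := (((Complex.hasDerivAt_cos _).comp z hlin).div
      ((Complex.hasDerivAt_sin _).comp z hlin) hsin).const_mul (π : ℂ)
    refine h.congr_deriv ?_
    have h1 := Complex.sin_sq_add_cos_sq (π * z)
    simp only [Function.comp_apply]
    field_simp
    linear_combination (-1 : ℂ) * h1
  have h := iteratedDerivWithin_cot_pi_mul_eq_mul_tsum_div_pow le_rfl hmem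
  rw [iteratedDerivWithin_one, hder.hasDerivWithinAt.derivWithin
    (UpperHalfPlane.isOpen_upperHalfPlaneSet.uniqueDiffWithinAt hmem)] at h
  have h2 : π ^ 2 / Complex.sin (π * z) ^ 2 = ∑' n : ℤ, 1 / (z + n) ^ 2 := by
    simpa using h
  rw [h2]
  exact hsum.hasSum

/-- The partial fraction expansion of `1 / (4 cosh (t / 2) ^ 2)`, with poles at the odd multiples of
`π * I`. -/
lemma hasSum_exp_neg_div_one_add_exp_neg_sq {t : ℝ} (ht : 0 < t) :
    HasSum (fun k : ℕ ↦ 2 * ((π * (2 * k + 1)) ^ 2 - t ^ 2) / (t ^ 2 + (π * (2 * k + 1)) ^ 2) ^ 2)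
      (rexp (-t) / (1 + rexp (-t)) ^ 2) := by
  have hpi : (π : ℂ) ≠ 0 := by exact_mod_cast pi_ne_zero
  set z : ℂ := 1 / 2 + t / (2 * π) * Complex.I with hz
  have hzim : 0 < z.im := by
    have : z = ((1 / 2 : ℝ) : ℂ) + ((t / (2 * π) : ℝ) : ℂ) * Complex.I := by
      rw [hz]; push_cast; ring
    rw [this, Complex.add_im, Complex.ofReal_im, Complex.im_ofReal_mul, Complex.I_im]
    have := pi_pos
    positivity
  have hsin : Complex.sin (π * z) = ((Real.cosh (t / 2) : ℝ) : ℂ) := by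
    rw [show π * z = (t / 2 : ℂ) * Complex.I + π / 2 by rw [hz]; field_simp; ring,
      Complex.sin_add_pi_div_two, Complex.cos_mul_I]
    push_cast; rfl
  have h := ((hasSum_int_one_div_add_sq hzim).mul_left (1 / (4 * π ^ 2) : ℂ)).nat_add_neg_add_one
  rw [hsin] at h
  have hval : rexp (-t) / (1 + rexp (-t)) ^ 2 = 1 / (4 * π ^ 2) * (π ^ 2 / cosh (t / 2) ^ 2) := by
    have h1 : rexp (-t) = rexp (-(t / 2)) ^ 2 := by rw [← Real.exp_nat_mul]; ring_nf
    have h2 : rexp (t / 2) = (rexp (-(t / 2)))⁻¹ := by rw [Real.exp_neg, inv_inv]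
    have h3 := Real.exp_pos (-(t / 2))
    rw [h1, Real.cosh_eq, h2]
    field_simp
    norm_num
  rw [← Complex.hasSum_ofReal, hval]
  push_cast at h ⊢
  refine h.congr_fun fun k ↦ ?_
  obtain ⟨p, hp⟩ : ∃ p : ℝ, p = π * (2 * k + 1) := ⟨_, rfl⟩
  have hp0 : 0 < p := by have := pi_pos; rw [hp]; positivity
  have hpc : (π : ℂ) * (2 * k + 1) = p := by rw [hp]; push_cast; rfl
  have e1 : z + k = (p + t * Complex.I) / (2 * π) := by
    rw [hz, ← hpc]; field_simp; ring
  have e2 : z + -((k : ℂ) + 1) = (-p + t * Complex.I) / (2 * π) := by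
    rw [hz, ← hpc]; field_simp; ring
  have k1 : (p : ℂ) + t * Complex.I ≠ 0 := fun h0 ↦ hp0.ne' (by
    simpa using congrArg Complex.re h0)
  have k2 : -(p : ℂ) + t * Complex.I ≠ 0 := fun h0 ↦ hp0.ne' (by
    simpa using congrArg Complex.re h0)
  have e3 : (t : ℂ) ^ 2 + p ^ 2 = -((p + t * Complex.I) * (-p + t * Complex.I)) := by
    linear_combination ((t : ℂ) ^ 2) * Complex.I_sq
  rw [hpc, e1, e2, e3]
  field_simp
  linear_combination (-4 * (t : ℂ) ^ 2) * Complex.I_sq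

lemma tendsto_arctan_div_atTop {a : ℝ} (ha : 0 < a) :
    Tendsto (fun t ↦ arctan (t / a)) atTop (𝓝 (π / 2)) :=
  (tendsto_nhds_of_tendsto_nhdsWithin tendsto_arctan_atTop).comp (tendsto_id.atTop_div_const ha)

lemma hasDerivAt_arctan_div {a : ℝ} (ha : a ≠ 0) (t : ℝ) :
    HasDerivAt (fun t ↦ arctan (t / a)) (a / (t ^ 2 + a ^ 2)) t := by
  refine ((hasDerivAt_id t).div_const a).arctan.congr_deriv ?_
  have : t ^ 2 + a ^ 2 ≠ 0 := by positivity
  simp only [id]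
  field_simp
  ring

lemma integrableOn_Ioi_one_div_sq_add_sq {a : ℝ} (ha : 0 < a) :
    IntegrableOn (fun t : ℝ ↦ 1 / (t ^ 2 + a ^ 2)) (Ioi 0) := by
  refine integrableOn_Ioi_deriv_of_nonneg' (g := fun t ↦ arctan (t / a) / a) (l := π / 2 / a)
    (fun t _ ↦ ?_) (fun t _ ↦ by positivity) ((tendsto_arctan_div_atTop ha).div_const a)
  refine ((hasDerivAt_arctan_div ha.ne' t).div_const a).congr_deriv ?_
  field_simp

lemma integral_Ioi_one_div_sq_add_sq {a : ℝ} (ha : 0 < a) :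
    ∫ t in Ioi (0 : ℝ), 1 / (t ^ 2 + a ^ 2) = π / (2 * a) := by
  rw [integral_Ioi_of_hasDerivAt_of_tendsto' (f := fun t ↦ arctan (t / a) / a) (m := π / 2 / a)
    (fun t _ ↦ ?_) (integrableOn_Ioi_one_div_sq_add_sq ha)
    ((tendsto_arctan_div_atTop ha).div_const a)]
  · simp; field_simp
  · refine ((hasDerivAt_arctan_div ha.ne' t).div_const a).congr_deriv ?_
    field_simp

lemma tendsto_div_sq_add_sq_atTop (a : ℝ) :
    Tendsto (fun t : ℝ ↦ t / (t ^ 2 + a ^ 2)) atTop (𝓝 0) := by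
  refine squeeze_zero' ?_ ?_ tendsto_inv_atTop_zero
  · filter_upwards [eventually_gt_atTop 0] with t ht using by positivity
  · filter_upwards [eventually_gt_atTop 0] with t ht
    rw [div_le_iff₀ (by positivity), inv_mul_eq_div, le_div_iff₀ ht]
    nlinarith [sq_nonneg a]

lemma hasDerivAt_div_sq_add_sq {a : ℝ} (ha : a ≠ 0) (t : ℝ) :
    HasDerivAt (fun t : ℝ ↦ t / (t ^ 2 + a ^ 2)) ((a ^ 2 - t ^ 2) / (t ^ 2 + a ^ 2) ^ 2) t := by
  have : t ^ 2 + a ^ 2 ≠ 0 := by positivity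
  refine ((hasDerivAt_id t).div ((hasDerivAt_pow 2 t).add_const (a ^ 2)) this).congr_deriv ?_
  simp only [id]
  field_simp
  ring

lemma norm_doublePole_mul_le (a : ℝ) {p : ℝ} (hp : 0 < p) (t : ℝ) :
    ‖2 * (p ^ 2 - t ^ 2) / (t ^ 2 + p ^ 2) ^ 2 * (1 / (t ^ 2 + a ^ 2))‖ ≤
      2 / p ^ 2 * (1 / (t ^ 2 + a ^ 2)) := by
  rw [norm_mul, Real.norm_of_nonneg (show 0 ≤ 1 / (t ^ 2 + a ^ 2) by positivity), norm_div,
    norm_mul, Real.norm_two, Real.norm_of_nonneg (show 0 ≤ (t ^ 2 + p ^ 2) ^ 2 by positivity)]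
  refine mul_le_mul_of_nonneg_right ?_ (by positivity)
  have h : ‖p ^ 2 - t ^ 2‖ ≤ t ^ 2 + p ^ 2 := by
    rw [Real.norm_eq_abs, abs_le]
    constructor <;> nlinarith [sq_nonneg t, sq_nonneg p]
  calc 2 * ‖p ^ 2 - t ^ 2‖ / (t ^ 2 + p ^ 2) ^ 2
      ≤ 2 * (t ^ 2 + p ^ 2) / (t ^ 2 + p ^ 2) ^ 2 := by gcongr
    _ = 2 / (t ^ 2 + p ^ 2) := by field_simp
    _ ≤ 2 / p ^ 2 := by gcongr; nlinarith [sq_nonneg t]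

lemma integrableOn_doublePole_mul {a p : ℝ} (ha : 0 < a) (hp : 0 < p) :
    IntegrableOn (fun t : ℝ ↦ 2 * (p ^ 2 - t ^ 2) / (t ^ 2 + p ^ 2) ^ 2 * (1 / (t ^ 2 + a ^ 2)))
      (Ioi 0) := by
  refine ((integrableOn_Ioi_one_div_sq_add_sq ha).const_mul (2 / p ^ 2)).mono' ?_
    (ae_of_all _ (norm_doublePole_mul_le a hp))
  exact (by fun_prop : Measurable _).aestronglyMeasurable

lemma integral_norm_doublePole_mul_le {a p : ℝ} (ha : 0 < a) (hp : 0 < p) :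
    ∫ t in Ioi (0 : ℝ), ‖2 * (p ^ 2 - t ^ 2) / (t ^ 2 + p ^ 2) ^ 2 * (1 / (t ^ 2 + a ^ 2))‖ ≤
      π / a * (1 / p ^ 2) := by
  calc _ ≤ ∫ t in Ioi (0 : ℝ), 2 / p ^ 2 * (1 / (t ^ 2 + a ^ 2)) :=
        integral_mono (integrableOn_doublePole_mul ha hp).norm
          ((integrableOn_Ioi_one_div_sq_add_sq ha).const_mul _) (norm_doublePole_mul_le a hp)
    _ = π / a * (1 / p ^ 2) := by
      rw [integral_const_mul, integral_Ioi_one_div_sq_add_sq ha]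
      field_simp

lemma integral_doublePole_mul_self {a : ℝ} (ha : 0 < a) :
    ∫ t in Ioi (0 : ℝ), 2 * (a ^ 2 - t ^ 2) / (t ^ 2 + a ^ 2) ^ 2 * (1 / (t ^ 2 + a ^ 2)) =
      π / a * (1 / (a + a) ^ 2) := by
  rw [integral_Ioi_of_hasDerivAt_of_tendsto' (m := 0 * 0 + 0 / (2 * a ^ 2) + π / 2 / (2 * a ^ 3))
    (f := fun t ↦ t / (t ^ 2 + a ^ 2) * (t ^ 2 + a ^ 2)⁻¹ + t / (t ^ 2 + a ^ 2) / (2 * a ^ 2) +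
      arctan (t / a) / (2 * a ^ 3)) (fun t _ ↦ ?_) (integrableOn_doublePole_mul ha ha)]
  · simp; field_simp; ring
  · refine (((tendsto_div_sq_add_sq_atTop a).mul (tendsto_inv_atTop_zero.comp ?_)).add
      ((tendsto_div_sq_add_sq_atTop a).div_const _)).add
      ((tendsto_arctan_div_atTop ha).div_const _)
    exact tendsto_atTop_add_const_right _ _ (tendsto_pow_atTop two_ne_zero)
  · have h := hasDerivAt_div_sq_add_sq ha.ne' t
    have h0 : t ^ 2 + a ^ 2 ≠ 0 := by positivity
    refine (((h.mul (((hasDerivAt_pow 2 t).add_const (a ^ 2)).inv h0)).add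
      (h.div_const _)).add ((hasDerivAt_arctan_div ha.ne' t).div_const _)).congr_deriv ?_
    simp
    field_simp
    ring

/-- The contribution of the double poles `±p * I`. -/
lemma integral_doublePole_mul {a p : ℝ} (ha : 0 < a) (hp : 0 < p) :
    ∫ t in Ioi (0 : ℝ), 2 * (p ^ 2 - t ^ 2) / (t ^ 2 + p ^ 2) ^ 2 * (1 / (t ^ 2 + a ^ 2)) =
      π / a * (1 / (a + p) ^ 2) := by
  rcases eq_or_ne a p with rfl | hap
  · exact integral_doublePole_mul_self ha
  have hd : p - a ≠ 0 := sub_ne_zero.mpr hap.symm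
  have hs : p + a ≠ 0 := by positivity
  set A : ℝ := 2 * (p ^ 2 + a ^ 2) / ((p - a) * (p + a)) ^ 2 with hA
  set C : ℝ := -(4 * p ^ 2) / ((p - a) * (p + a)) with hC
  rw [integral_Ioi_of_hasDerivAt_of_tendsto' (m := A / a * (π / 2) +
      (C / (2 * p ^ 3) - A / p) * (π / 2) + C / (2 * p ^ 2) * 0)
    (f := fun t ↦ A / a * arctan (t / a) + (C / (2 * p ^ 3) - A / p) * arctan (t / p) +
      C / (2 * p ^ 2) * (t / (t ^ 2 + p ^ 2))) (fun t _ ↦ ?_) (integrableOn_doublePole_mul ha hp)]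
  · simp only [zero_div, arctan_zero, mul_zero, add_zero, sub_zero, hA, hC]
    rw [add_comm a p]
    field_simp
    ring
  · exact (((tendsto_arctan_div_atTop ha).const_mul _).add
      ((tendsto_arctan_div_atTop hp).const_mul _)).add
      ((tendsto_div_sq_add_sq_atTop p).const_mul _)
  · have h0 : t ^ 2 + a ^ 2 ≠ 0 := by positivity
    have h1 : t ^ 2 + p ^ 2 ≠ 0 := by positivity
    refine ((((hasDerivAt_arctan_div ha.ne' t).const_mul _).add
      ((hasDerivAt_arctan_div hp.ne' t).const_mul _)).add
      ((hasDerivAt_div_sq_add_sq hp.ne' t).const_mul _)).congr_deriv ?_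
    rw [hA, hC]
    field_simp
    ring

lemma integral_zero_one_eq_integral_Ioi (f : ℝ → ℝ) :
    ∫ x in (0 : ℝ)..1, f x = ∫ t in Ioi (0 : ℝ), rexp (-t) * f (rexp (-t)) := by
  have himg : (fun t ↦ rexp (-t)) '' Ioi 0 = Ioo 0 1 := by
    ext x
    constructor
    · rintro ⟨t, ht, rfl⟩
      exact ⟨exp_pos _, by simpa using ht⟩
    · rintro ⟨h0, h1⟩
      exact ⟨-log x, by simpa using log_neg h0 h1, by simp [exp_log h0]⟩
  rw [intervalIntegral.integral_of_le zero_le_one, integral_Ioc_eq_integral_Ioo, ← himg,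
    integral_image_eq_integral_abs_deriv_smul (f' := fun t ↦ -rexp (-t)) measurableSet_Ioi
      (fun t _ ↦ by simpa using ((hasDerivAt_neg t).exp).hasDerivWithinAt)
      (fun x _ y _ h ↦ by simpa using h)]
  simp

theorem bdh_integral_twelve (a : ℝ) (ha : 0 < a) :
    (∫ x in (0:ℝ)..1, 1 / ((a ^ 2 + Real.log x ^ 2) * (1 + x) ^ 2)) =
      -(1 / (4 * a * π)) * trigamma (a / (2 * π)) +
        (1 / (a * π)) * trigamma (a / π) := by
  have hpi := pi_pos
  have hp (k : ℕ) : 0 < π * (2 * k + 1) := by positivity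
  have hsq : Summable fun k : ℕ ↦ 1 / (π * (2 * (k : ℝ) + 1)) ^ 2 := by
    refine ((summable_one_div_add_sq (x := 1 / 2) (by norm_num)).mul_left
      (1 / (4 * π ^ 2))).congr fun k ↦ ?_
    field_simp
    ring
  have hsum := hasSum_integral_of_summable_integral_norm (μ := volume.restrict (Ioi 0))
    (fun k ↦ integrableOn_doublePole_mul ha (hp k))
    (.of_nonneg_of_le (fun k ↦ integral_nonneg fun _ ↦ norm_nonneg _)
      (fun k ↦ integral_norm_doublePole_mul_le ha (hp k)) (hsq.mul_left _))
  simp_rw [integral_doublePole_mul ha (hp _)] at hsum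
  have hint : ∫ x in (0:ℝ)..1, 1 / ((a ^ 2 + Real.log x ^ 2) * (1 + x) ^ 2) =
      ∫ t in Ioi (0 : ℝ), ∑' k : ℕ, 2 * ((π * (2 * k + 1)) ^ 2 - t ^ 2) /
        (t ^ 2 + (π * (2 * k + 1)) ^ 2) ^ 2 * (1 / (t ^ 2 + a ^ 2)) := by
    rw [integral_zero_one_eq_integral_Ioi]
    refine setIntegral_congr_fun measurableSet_Ioi fun t ht ↦ ?_
    rw [((hasSum_exp_neg_div_one_add_exp_neg_sq ht).mul_right _).tsum_eq, log_exp, neg_sq,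
      add_comm (t ^ 2), div_mul_div_comm, mul_one_div, mul_one, mul_comm (a ^ 2 + t ^ 2)]
  rw [hint]
  have hdup := (hasSum_trigamma_duplication (x := a / (2 * π)) (by positivity)).mul_left
    (1 / (4 * π * a))
  rw [show 2 * (a / (2 * π)) = a / π by field_simp] at hdup
  rw [hsum.unique (hdup.congr_fun fun k ↦ ?_)]
  · field_simp
    ring
  · field_simp
    ring
end

section
/- For every real number a > 0, the integral ∫₀¹ (ln x)/((a² + (ln x)²)(1 + x)) dx equals (1/2)·ln(2a/π) + (1/2)·ψ(a/(2π)) − ψ(a/π). -/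
open Real MeasureTheory

section BinetIntegral

open Set Filter Topology

lemma differentiableAt_log_Gamma_s13 {x : ℝ} (hx : 0 < x) :
    DifferentiableAt ℝ (Real.log ∘ Real.Gamma) x :=
  (differentiableAt_Gamma fun m => by
    have : (0 : ℝ) ≤ m := m.cast_nonneg
    linarith).log (Gamma_pos_of_pos hx).ne'

lemma log_Gamma_add_one {x : ℝ} (hx : 0 < x) :
    Real.log (Real.Gamma (x + 1)) = Real.log x + Real.log (Real.Gamma x) := by
  rw [Gamma_add_one hx.ne', Real.log_mul hx.ne' (Gamma_pos_of_pos hx).ne']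

lemma digamma_add_one {x : ℝ} (hx : 0 < x) : digamma (x + 1) = digamma x + 1 / x := by
  have h1 : digamma (x + 1) = deriv (fun y => Real.log (Real.Gamma (y + 1))) x :=
    (deriv_comp_add_const (fun y => Real.log (Real.Gamma y)) 1 x).symm
  have h2 : (fun y => Real.log (Real.Gamma (y + 1))) =ᶠ[𝓝 x]
      fun y => Real.log (Real.Gamma y) + Real.log y := by
    filter_upwards [lt_mem_nhds hx] with y hy
    rw [log_Gamma_add_one hy, add_comm]
  rw [h1, h2.deriv_eq]
  have h3 := (differentiableAt_log_Gamma_s13 hx).hasDerivAt.add (Real.hasDerivAt_log hx.ne')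
  rw [one_div]
  exact h3.deriv

lemma digamma_le_log {x : ℝ} (hx : 0 < x) : digamma x ≤ Real.log x := by
  have hx1 : 0 < x + 1 := by linarith
  have h := convexOn_log_Gamma.deriv_le_slope (mem_Ioi.2 hx) (mem_Ioi.2 hx1) (by linarith)
    (differentiableAt_log_Gamma_s13 hx)
  simp only [slope_def_field, Function.comp_apply, log_Gamma_add_one hx] at h
  simpa [digamma, Function.comp_def] using h

lemma log_sub_inv_le_digamma {x : ℝ} (hx : 0 < x) : Real.log x - 1 / x ≤ digamma x := by
  have hx1 : 0 < x + 1 := by linarith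
  have h := convexOn_log_Gamma.slope_le_deriv (mem_Ioi.2 hx) (mem_Ioi.2 hx1) (by linarith)
    (differentiableAt_log_Gamma_s13 hx1)
  simp only [slope_def_field, Function.comp_apply, log_Gamma_add_one hx] at h
  have h' : Real.log x ≤ digamma (x + 1) := by
    simpa [digamma, Function.comp_def] using h
  rw [digamma_add_one hx] at h'
  linarith

lemma exp_sub_one_pos {t : ℝ} (ht : 0 < t) : 0 < Real.exp t - 1 := by
  have := Real.add_one_lt_exp ht.ne'
  linarith

lemma div_exp_sub_one_le {t : ℝ} (ht : 0 < t) :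
    t / (Real.exp t - 1) ≤ Real.exp (-(1 / 2) * t) := by
  rw [div_le_iff₀ (exp_sub_one_pos ht)]
  have h := Real.self_le_sinh_iff.2 (half_pos ht).le
  rw [Real.sinh_eq] at h
  have h1 : Real.exp (-(1 / 2) * t) * (Real.exp t - 1) =
      Real.exp (t / 2) - Real.exp (-(t / 2)) := by
    rw [mul_sub, ← Real.exp_add]
    ring_nf
  rw [h1]
  linarith

lemma integrableOn_div_exp_sub_one :
    IntegrableOn (fun t : ℝ => t / (Real.exp t - 1)) (Ioi 0) := by
  refine Integrable.mono' (integrableOn_exp_mul_Ioi (a := -(1 / 2)) (by norm_num) 0)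
    (Measurable.aestronglyMeasurable (by fun_prop)) ?_
  filter_upwards [ae_restrict_mem measurableSet_Ioi] with t ht
  rw [Real.norm_of_nonneg (div_nonneg (le_of_lt ht) (exp_sub_one_pos ht).le)]
  exact div_exp_sub_one_le ht

lemma integral_exp_neg_mul_mul_sin {b : ℝ} (hb : 0 < b) (s : ℝ) :
    ∫ t in Ioi (0 : ℝ), Real.exp (-b * t) * Real.sin (s * t) = s / (b ^ 2 + s ^ 2) := by
  have hre : (-(b : ℂ) + s * Complex.I).re < 0 := by simpa using hb
  have h := congrArg Complex.im (integral_exp_mul_complex_Ioi hre 0)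
  have him := integral_im (integrableOn_exp_mul_complex_Ioi hre 0)
  simp only [RCLike.im_to_complex] at him
  rw [← him] at h
  convert h using 1
  · refine integral_congr_ae (ae_of_all _ fun t => ?_)
    simp [Complex.exp_im]
  · have : b ^ 2 + s ^ 2 ≠ 0 := by positivity
    simp [Complex.div_im, Complex.normSq_apply]
    field_simp

lemma integral_mul_exp_neg_mul {b : ℝ} (hb : 0 < b) :
    ∫ t in Ioi (0 : ℝ), t * Real.exp (-b * t) = 1 / b ^ 2 := by
  have h := Real.integral_rpow_mul_exp_neg_mul_Ioi (a := 2) two_pos hb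
  norm_num [Real.Gamma_two] at h
  simpa using h

lemma integrableOn_mul_exp_neg_mul {b : ℝ} (hb : 0 < b) :
    IntegrableOn (fun t : ℝ => t * Real.exp (-b * t)) (Ioi 0) :=
  .of_integral_ne_zero (by rw [integral_mul_exp_neg_mul hb]; positivity)

lemma abs_exp_mul_sin_le {b s t : ℝ} (hs : 0 < s) (ht : 0 < t) :
    ‖Real.exp (-b * t) * Real.sin (s * t)‖ ≤ s * (t * Real.exp (-b * t)) := by
  rw [norm_mul, Real.norm_eq_abs, Real.norm_eq_abs, Real.abs_exp]
  have h : |Real.sin (s * t)| ≤ |s * t| := abs_sin_le_abs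
  rw [abs_of_pos (mul_pos hs ht)] at h
  nlinarith [Real.exp_pos (-b * t)]

lemma integrableOn_exp_neg_mul_mul_sin {b s : ℝ} (hb : 0 < b) (hs : 0 < s) :
    IntegrableOn (fun t : ℝ => Real.exp (-b * t) * Real.sin (s * t)) (Ioi 0) := by
  refine Integrable.mono' ((integrableOn_mul_exp_neg_mul hb).const_mul s)
    (Continuous.aestronglyMeasurable (by fun_prop)) ?_
  filter_upwards [ae_restrict_mem measurableSet_Ioi] with t ht
  exact abs_exp_mul_sin_le hs ht

lemma tsum_exp_neg_succ_mul {t : ℝ} (ht : 0 < t) :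
    ∑' n : ℕ, Real.exp (-((n : ℝ) + 1) * t) = 1 / (Real.exp t - 1) := by
  have h : HasSum (fun n : ℕ => Real.exp (-t) * Real.exp (-t) ^ n)
      (Real.exp (-t) * (1 - Real.exp (-t))⁻¹) :=
    (hasSum_geometric_of_lt_one (Real.exp_pos _).le (by simpa using ht)).mul_left _
  have h1 := exp_sub_one_pos ht
  have h2 : Real.exp (-t) * (1 - Real.exp (-t))⁻¹ = 1 / (Real.exp t - 1) := by
    rw [Real.exp_neg]
    have := Real.exp_pos t
    have h3 : 1 - (Real.exp t)⁻¹ ≠ 0 := by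
      have : 1 - (Real.exp t)⁻¹ = (Real.exp t - 1) / Real.exp t := by field_simp
      rw [this]; positivity
    field_simp
  rw [← h2, ← h.tsum_eq]
  congr 1 with n
  rw [← Real.exp_nat_mul, ← Real.exp_add]
  ring_nf

lemma hasSum_integral_sin_div_exp_sub_one {s : ℝ} (hs : 0 < s) :
    HasSum (fun n : ℕ => s / (((n : ℝ) + 1) ^ 2 + s ^ 2))
      (∫ t in Ioi (0 : ℝ), Real.sin (s * t) / (Real.exp t - 1)) := by
  have hn (n : ℕ) : (0 : ℝ) < (n : ℝ) + 1 := n.cast_add_one_pos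
  have h := hasSum_integral_of_summable_integral_norm
    (μ := volume.restrict (Ioi (0 : ℝ)))
    (F := fun (n : ℕ) t => Real.exp (-((n : ℝ) + 1) * t) * Real.sin (s * t))
    (fun n => integrableOn_exp_neg_mul_mul_sin (hn n) hs) ?_
  · simp only [integral_exp_neg_mul_mul_sin (hn _)] at h
    rwa [setIntegral_congr_fun (g := fun t => Real.sin (s * t) / (Real.exp t - 1))
      measurableSet_Ioi fun t ht => ?_] at h
    simp only
    rw [tsum_mul_right, tsum_exp_neg_succ_mul ht]
    ring
  · have hsum : Summable fun n : ℕ => s * (1 / ((n : ℝ) + 1) ^ 2) := by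
      have := (summable_nat_add_iff 1).2 (Real.summable_one_div_nat_pow.2 one_lt_two)
      simpa using this.mul_left s
    refine Summable.of_nonneg_of_le (fun n => ?_) (fun n => ?_) hsum
    · exact integral_nonneg fun _ => norm_nonneg _
    rw [← integral_mul_exp_neg_mul (hn n), ← integral_const_mul]
    refine setIntegral_mono_on (integrableOn_exp_neg_mul_mul_sin (hn n) hs).norm
      ((integrableOn_mul_exp_neg_mul (hn n)).const_mul s) measurableSet_Ioi fun t ht => ?_
    exact abs_exp_mul_sin_le hs ht

lemma tsum_div_sq_add_sq {s : ℝ} (hs : 0 < s) :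
    ∑' n : ℕ, s / (((n : ℝ) + 1) ^ 2 + s ^ 2) =
      (π * ((1 + Real.exp (-(2 * π) * s)) / (1 - Real.exp (-(2 * π) * s))) - 1 / s) / 2 := by
  have hmem : (s : ℂ) * Complex.I ∈ Complex.integerComplement := by
    rw [Complex.mem_integerComplement_iff]
    rintro ⟨n, hn⟩
    have := congrArg Complex.im hn
    simp at this
    exact hs.ne this
  have h := cot_series_rep' hmem
  have hexp : Complex.exp (2 * Complex.I * (π * (s * Complex.I))) =
      (Real.exp (-(2 * π) * s) : ℝ) := by
    push_cast
    congr 1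
    linear_combination (2 * π * s : ℂ) * Complex.I_mul_I
  have hterm (n : ℕ) : 1 / ((s : ℂ) * Complex.I - (n + 1)) + 1 / (s * Complex.I + (n + 1)) =
      (-2 * Complex.I) * ((s / (((n : ℝ) + 1) ^ 2 + s ^ 2) : ℝ) : ℂ) := by
    have hpos : (0 : ℝ) < ((n : ℝ) + 1) ^ 2 + s ^ 2 := by positivity
    have h1 : (s : ℂ) * Complex.I - (n + 1) ≠ 0 := by
      intro h0
      have := congrArg Complex.im h0
      simp at this
      exact hs.ne' this
    have h2 : (s : ℂ) * Complex.I + (n + 1) ≠ 0 := by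
      intro h0
      have := congrArg Complex.im h0
      simp at this
      exact hs.ne' this
    have h3 : (((n : ℂ) + 1) ^ 2 + s ^ 2) ≠ 0 := by exact_mod_cast hpos.ne'
    push_cast
    field_simp
    linear_combination (2 * s ^ 3 * Complex.I : ℂ) * Complex.I_sq
  simp only [hterm] at h
  rw [tsum_mul_left, ← Complex.ofReal_tsum, Complex.cot_eq_exp_ratio, hexp] at h
  have hlt : Real.exp (-(2 * π) * s) < 1 := by
    rw [Real.exp_lt_one_iff]
    nlinarith [pi_pos]
  have h1 : (1 - (Real.exp (-(2 * π) * s) : ℂ)) ≠ 0 := by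
    exact_mod_cast (sub_pos.2 hlt).ne'
  have hsC : (s : ℂ) ≠ 0 := by exact_mod_cast hs.ne'
  have hI := Complex.I_ne_zero
  apply Complex.ofReal_injective
  push_cast at h h1 ⊢
  have e1 : (Complex.I)⁻¹ = -Complex.I := Complex.inv_I
  generalize (∑' n : ℕ, (s : ℂ) / (((n : ℂ) + 1) ^ 2 + s ^ 2)) = T at h ⊢
  generalize Complex.exp (-(2 * π) * s) = q at h h1 ⊢
  have key : π * ((q + 1) / (Complex.I * (1 - q))) - 1 / (s * Complex.I) =
      -Complex.I * (π * ((1 + q) / (1 - q)) - 1 / s) := by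
    rw [div_mul_eq_div_div_swap, div_mul_eq_div_div_swap, div_eq_mul_inv _ Complex.I,
      div_eq_mul_inv _ Complex.I, e1]
    ring
  rw [key] at h
  have h4 : -Complex.I * (2 * T) = -Complex.I * (π * ((1 + q) / (1 - q)) - 1 / s) := by
    rw [h]; ring
  have h5 := mul_left_cancel₀ (neg_ne_zero.2 hI) h4
  rw [← h5]; ring

lemma integral_sin_div_exp_sub_one {s : ℝ} (hs : 0 < s) :
    ∫ t in Ioi (0 : ℝ), Real.sin (s * t) / (Real.exp t - 1) =
      (π * ((1 + Real.exp (-(2 * π) * s)) / (1 - Real.exp (-(2 * π) * s))) - 1 / s) / 2 := by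
  rw [← (hasSum_integral_sin_div_exp_sub_one hs).tsum_eq, tsum_div_sq_add_sq hs]

/-- Binet's integral `∫₀^∞ t / ((a² + t²) (eᵗ - 1)) dt`. -/
noncomputable def binetIntegral (a : ℝ) : ℝ :=
  ∫ t in Ioi (0 : ℝ), t / ((a ^ 2 + t ^ 2) * (Real.exp t - 1))

lemma integrable_binet_kernel {a : ℝ} (ha : 0 < a) :
    Integrable (Function.uncurry fun s t : ℝ =>
        Real.exp (-a * s) * Real.sin (s * t) / (Real.exp t - 1))
      ((volume.restrict (Ioi (0 : ℝ))).prod (volume.restrict (Ioi (0 : ℝ)))) := by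
  have hm : Measurable (Function.uncurry fun s t : ℝ =>
      Real.exp (-a * s) * Real.sin (s * t) / (Real.exp t - 1)) := by
    unfold Function.uncurry
    fun_prop
  refine Integrable.mono'
    ((integrableOn_mul_exp_neg_mul ha).integrable.mul_prod integrableOn_div_exp_sub_one.integrable)
    hm.aestronglyMeasurable ?_
  rw [Measure.prod_restrict]
  filter_upwards [ae_restrict_mem (measurableSet_Ioi.prod measurableSet_Ioi)] with p hp
  obtain ⟨hs, ht⟩ := hp
  have hs : 0 < p.1 := hs
  have ht : 0 < p.2 := ht
  have hpos := exp_sub_one_pos ht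
  have h : |Real.sin (p.1 * p.2)| ≤ |p.1 * p.2| := abs_sin_le_abs
  rw [abs_of_pos (mul_pos hs ht)] at h
  simp only [Function.uncurry]
  rw [norm_div, norm_mul, Real.norm_eq_abs, Real.norm_eq_abs, Real.norm_eq_abs, Real.abs_exp,
    abs_of_pos hpos, ← mul_div_assoc]
  refine div_le_div_of_nonneg_right ?_ hpos.le
  nlinarith [Real.exp_pos (-a * p.1)]

lemma binetIntegral_eq {a : ℝ} (ha : 0 < a) :
    binetIntegral a = ∫ s in Ioi (0 : ℝ), Real.exp (-a * s) *
      ∫ t in Ioi (0 : ℝ), Real.sin (s * t) / (Real.exp t - 1) := by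
  have h := integral_integral_swap (integrable_binet_kernel ha)
  simp only [mul_div_assoc, integral_const_mul] at h
  rw [h, binetIntegral]
  refine setIntegral_congr_fun measurableSet_Ioi fun t _ => ?_
  simp only [← mul_div_assoc]
  rw [integral_div]
  simp only [mul_comm _ t]
  rw [integral_exp_neg_mul_mul_sin ha, div_div]

lemma integrableOn_exp_mul_integral_sin {a : ℝ} (ha : 0 < a) :
    IntegrableOn (fun s : ℝ => Real.exp (-a * s) *
      ∫ t in Ioi (0 : ℝ), Real.sin (s * t) / (Real.exp t - 1)) (Ioi 0) := by
  have h := (integrable_binet_kernel ha).integral_prod_left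
  simpa only [IntegrableOn, Function.uncurry, mul_div_assoc, integral_const_mul] using h

lemma binetIntegral_sub_add_two_pi {a : ℝ} (ha : 0 < a) :
    binetIntegral a - binetIntegral (a + 2 * π) =
      (π / a + π / (a + 2 * π) - Real.log ((a + 2 * π) / a)) / 2 := by
  have hb : 0 < a + 2 * π := by positivity
  set b := a + 2 * π with hbdef
  have hea := integrableOn_exp_mul_Ioi (neg_lt_zero.2 ha) 0
  have heb := integrableOn_exp_mul_Ioi (neg_lt_zero.2 hb) 0
  have hia := integrableOn_exp_mul_integral_sin ha
  have hib := integrableOn_exp_mul_integral_sin hb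
  have key : ∀ s ∈ Ioi (0 : ℝ),
      s⁻¹ • (Real.exp (-(a * s)) - Real.exp (-(b * s))) =
        (π * Real.exp (-a * s) + π * Real.exp (-b * s)) -
        2 * ((Real.exp (-a * s) * ∫ t in Ioi (0 : ℝ), Real.sin (s * t) / (Real.exp t - 1)) -
          Real.exp (-b * s) * ∫ t in Ioi (0 : ℝ), Real.sin (s * t) / (Real.exp t - 1)) := by
    intro s hs
    have hs : 0 < s := hs
    rw [integral_sin_div_exp_sub_one hs]
    have hlt : Real.exp (-(2 * π) * s) < 1 := by
      rw [Real.exp_lt_one_iff]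
      nlinarith [pi_pos]
    have hbs : Real.exp (-b * s) = Real.exp (-a * s) * Real.exp (-(2 * π) * s) := by
      rw [← Real.exp_add, hbdef]
      ring_nf
    rw [← neg_mul, ← neg_mul, hbs, smul_eq_mul]
    have := (sub_pos.2 hlt).ne'
    generalize Real.exp (-(2 * π) * s) = q at this ⊢
    field_simp
    ring
  have hint : IntegrableOn
      (fun s : ℝ => s⁻¹ • (Real.exp (-(a * s)) - Real.exp (-(b * s)))) (Ioi 0) :=
    (integrableOn_congr_fun key measurableSet_Ioi).2
      (((hea.const_mul π).add (heb.const_mul π)).sub ((hia.sub hib).const_mul 2))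
  have hF := Frullani.integral_Ioi_eq (f := fun x : ℝ => Real.exp (-x)) (L := 1) (R := 0)
    ((Continuous.locallyIntegrable (by fun_prop)).locallyIntegrableOn _) ha hb
    (by
      have : Tendsto (fun x : ℝ => Real.exp (-x)) (𝓝 0) (𝓝 (Real.exp (-0))) :=
        Continuous.tendsto (by fun_prop) 0
      simpa using this.mono_left nhdsWithin_le_nhds)
    Real.tendsto_exp_neg_atTop_nhds_zero hint
  rw [setIntegral_congr_fun measurableSet_Ioi key,
    integral_sub (by exact (hea.const_mul π).add (heb.const_mul π))
      (by exact (hia.sub hib).const_mul 2),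
    integral_add (hea.const_mul π) (heb.const_mul π), integral_const_mul, integral_const_mul,
    integral_const_mul, integral_sub hia hib, ← binetIntegral_eq ha, ← binetIntegral_eq hb,
    integral_exp_mul_Ioi (neg_lt_zero.2 ha), integral_exp_mul_Ioi (neg_lt_zero.2 hb)] at hF
  simp at hF
  rw [div_eq_mul_inv π, div_eq_mul_inv π]
  linarith

lemma integrableOn_binet {a : ℝ} (ha : 0 < a) :
    IntegrableOn (fun t : ℝ => t / ((a ^ 2 + t ^ 2) * (Real.exp t - 1))) (Ioi 0) := by
  refine Integrable.mono' (integrableOn_div_exp_sub_one.const_mul (1 / a ^ 2))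
    (Measurable.aestronglyMeasurable (by fun_prop)) ?_
  filter_upwards [ae_restrict_mem measurableSet_Ioi] with t ht
  have ht : 0 < t := ht
  have hpos := exp_sub_one_pos ht
  rw [Real.norm_of_nonneg (by positivity), div_mul_div_comm, one_mul]
  gcongr
  nlinarith [sq_nonneg t]

lemma tendsto_binetIntegral_atTop : Tendsto binetIntegral atTop (𝓝 0) := by
  have hlim : Tendsto (fun a : ℝ => 1 / a ^ 2 * ∫ t in Ioi (0 : ℝ), t / (Real.exp t - 1))
      atTop (𝓝 0) := by
    have : Tendsto (fun a : ℝ => 1 / a ^ 2) atTop (𝓝 0) := by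
      simpa [Function.comp_def] using
        tendsto_inv_atTop_zero.comp (tendsto_pow_atTop (α := ℝ) two_ne_zero)
    simpa using this.mul_const (∫ t in Ioi (0 : ℝ), t / (Real.exp t - 1))
  refine tendsto_of_tendsto_of_tendsto_of_le_of_le' tendsto_const_nhds hlim ?_ ?_
  · refine Eventually.of_forall fun a => setIntegral_nonneg measurableSet_Ioi fun t ht => ?_
    have ht : 0 < t := ht
    have hpos := exp_sub_one_pos ht
    positivity
  · filter_upwards [eventually_gt_atTop 0] with a ha
    rw [binetIntegral, ← integral_const_mul]
    refine setIntegral_mono_on (integrableOn_binet ha)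
      (integrableOn_div_exp_sub_one.const_mul (1 / a ^ 2)) measurableSet_Ioi fun t ht => ?_
    have ht : 0 < t := ht
    have hpos := exp_sub_one_pos ht
    rw [div_mul_div_comm, one_mul]
    gcongr
    nlinarith [sq_nonneg t]

/-- **Binet's second formula** for the digamma function. -/
theorem binetIntegral_two_pi_mul {z : ℝ} (hz : 0 < z) :
    binetIntegral (2 * π * z) = (Real.log z - 1 / (2 * z) - digamma z) / 2 := by
  set D : ℝ → ℝ := fun z =>
    binetIntegral (2 * π * z) - (Real.log z - 1 / (2 * z) - digamma z) / 2 with hD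
  have hstep {z : ℝ} (hz : 0 < z) : D (z + 1) = D z := by
    have h := binetIntegral_sub_add_two_pi (a := 2 * π * z) (by positivity)
    have e1 : 2 * π * z + 2 * π = 2 * π * (z + 1) := by ring
    have e2 : 2 * π * (z + 1) / (2 * π * z) = (z + 1) / z := by field_simp
    rw [e1, e2, Real.log_div (by positivity) hz.ne'] at h
    have e3 : π / (2 * π * z) = 1 / (2 * z) := by field_simp
    have e4 : π / (2 * π * (z + 1)) = 1 / (2 * (z + 1)) := by field_simp
    have e5 : 1 / z = 1 / (2 * z) + 1 / (2 * z) := by field_simp; norm_num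
    rw [e3, e4] at h
    simp only [hD]
    rw [digamma_add_one hz, e5]
    linarith
  have hnat (n : ℕ) : D (z + n) = D z := by
    induction n with
    | zero => simp
    | succ n ih =>
      rw [← ih, ← hstep (by positivity : 0 < z + n)]
      push_cast
      ring_nf
  have hinv : Tendsto (fun z : ℝ => 1 / z) atTop (𝓝 0) := by
    simpa using tendsto_inv_atTop_zero (𝕜 := ℝ)
  have hpsi : Tendsto (fun z : ℝ => Real.log z - digamma z) atTop (𝓝 0) := by
    refine tendsto_of_tendsto_of_tendsto_of_le_of_le' tendsto_const_nhds hinv ?_ ?_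
    · filter_upwards [eventually_gt_atTop 0] with x hx
      linarith [digamma_le_log hx]
    · filter_upwards [eventually_gt_atTop 0] with x hx
      linarith [log_sub_inv_le_digamma hx]
  have hlim : Tendsto D atTop (𝓝 0) := by
    have h1 : Tendsto (fun z : ℝ => binetIntegral (2 * π * z)) atTop (𝓝 0) :=
      tendsto_binetIntegral_atTop.comp (tendsto_id.const_mul_atTop (by positivity))
    have h2 := h1.sub ((hpsi.sub (hinv.div_const 2)).div_const 2)
    simp only [zero_div, sub_zero] at h2
    refine h2.congr fun x => ?_
    simp only [hD]
    rw [div_div, mul_comm x 2]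
    ring
  have hconst : Tendsto (fun n : ℕ => D (z + n)) atTop (𝓝 0) :=
    hlim.comp (tendsto_const_nhds.add_atTop tendsto_natCast_atTop_atTop)
  simp only [hnat] at hconst
  have := tendsto_nhds_unique tendsto_const_nhds hconst
  simp only [hD] at this
  linarith

lemma integral_zero_one_eq_integral_exp_neg (g : ℝ → ℝ) :
    ∫ x in (0 : ℝ)..1, g x = ∫ t in Ioi (0 : ℝ), Real.exp (-t) * g (Real.exp (-t)) := by
  have himg : (fun t : ℝ => Real.exp (-t)) '' Ioi 0 = Ioo 0 1 := by
    ext x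
    constructor
    · rintro ⟨t, ht, rfl⟩
      exact ⟨Real.exp_pos _, by simpa using ht⟩
    · rintro ⟨h0, h1⟩
      exact ⟨-Real.log x, by simpa using Real.log_neg h0 h1, by simp [Real.exp_log h0]⟩
  rw [intervalIntegral.integral_of_le zero_le_one, integral_Ioc_eq_integral_Ioo, ← himg,
    integral_image_eq_integral_abs_deriv_smul (f' := fun t => -Real.exp (-t)) measurableSet_Ioi
      (fun t _ => by simpa using (hasDerivAt_neg t).exp.hasDerivWithinAt)
      (fun x _ y _ h => by simpa using h)]
  simp

lemma integral_double_binet {a : ℝ} :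
    ∫ t in Ioi (0 : ℝ), 2 * t / ((a ^ 2 + t ^ 2) * (Real.exp (2 * t) - 1)) =
      2 * binetIntegral (2 * a) := by
  have h := integral_comp_mul_left_Ioi
    (fun t => t / (((2 * a) ^ 2 + t ^ 2) * (Real.exp t - 1))) 0 two_pos
  rw [mul_zero, smul_eq_mul] at h
  rw [binetIntegral]
  have h4 : ∀ t : ℝ, 2 * t / ((a ^ 2 + t ^ 2) * (Real.exp (2 * t) - 1)) =
      4 * (2 * t / (((2 * a) ^ 2 + (2 * t) ^ 2) * (Real.exp (2 * t) - 1))) := by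
    intro t
    rw [show (2 * a) ^ 2 + (2 * t) ^ 2 = 4 * (a ^ 2 + t ^ 2) by ring, mul_assoc 4,
      ← mul_div_assoc, mul_div_mul_left _ _ four_ne_zero]
  simp only [h4]
  rw [integral_const_mul, h]
  ring

lemma integrableOn_double_binet {a : ℝ} (ha : 0 < a) :
    IntegrableOn (fun t : ℝ => 2 * t / ((a ^ 2 + t ^ 2) * (Real.exp (2 * t) - 1))) (Ioi 0) := by
  refine Integrable.mono' (integrableOn_binet ha)
    (Measurable.aestronglyMeasurable (by fun_prop)) ?_
  filter_upwards [ae_restrict_mem measurableSet_Ioi] with t ht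
  have ht : 0 < t := ht
  have hpos := exp_sub_one_pos ht
  have hpos2 := exp_sub_one_pos (mul_pos two_pos ht)
  rw [Real.norm_of_nonneg (by positivity), div_le_div_iff₀ (by positivity) (by positivity)]
  have he : Real.exp (2 * t) = Real.exp t * Real.exp t := by rw [← Real.exp_add]; ring_nf
  have h2 : 2 * (Real.exp t - 1) ≤ Real.exp (2 * t) - 1 := by
    rw [he]
    nlinarith
  have h3 : 0 ≤ t * (a ^ 2 + t ^ 2) := by positivity
  nlinarith [mul_le_mul_of_nonneg_left h2 h3]

end BinetIntegral

theorem bdh_integral_fourteen (a : ℝ) (ha : 0 < a) :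
    (∫ x in (0:ℝ)..1, Real.log x / ((a ^ 2 + Real.log x ^ 2) * (1 + x))) =
      (1 / 2) * Real.log (2 * a / π) +
        (1 / 2) * digamma (a / (2 * π)) - digamma (a / π) := by
  have key : ∀ t ∈ Set.Ioi (0 : ℝ), Real.exp (-t) * (Real.log (Real.exp (-t)) /
      ((a ^ 2 + Real.log (Real.exp (-t)) ^ 2) * (1 + Real.exp (-t)))) =
      2 * t / ((a ^ 2 + t ^ 2) * (Real.exp (2 * t) - 1)) -
        t / ((a ^ 2 + t ^ 2) * (Real.exp t - 1)) := by
    intro t ht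
    have hpos := exp_sub_one_pos ht
    have he : Real.exp (2 * t) - 1 = (Real.exp t - 1) * (Real.exp t + 1) := by
      rw [two_mul, Real.exp_add]
      ring
    have hexp := Real.exp_pos t
    have hden : 0 < a ^ 2 + t ^ 2 := by positivity
    rw [Real.log_exp, he, Real.exp_neg, neg_sq]
    field_simp
    ring
  rw [integral_zero_one_eq_integral_exp_neg, setIntegral_congr_fun measurableSet_Ioi key,
    integral_sub (integrableOn_double_binet ha) (integrableOn_binet ha), integral_double_binet,
    ← binetIntegral]
  have h1 := binetIntegral_two_pi_mul (z := a / (2 * π)) (by positivity)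
  have h2 := binetIntegral_two_pi_mul (z := a / π) (by positivity)
  rw [show 2 * π * (a / (2 * π)) = a by field_simp,
    show 1 / (2 * (a / (2 * π))) = π / a by field_simp] at h1
  rw [show 2 * π * (a / π) = 2 * a by field_simp,
    show 1 / (2 * (a / π)) = π / a / 2 by field_simp] at h2
  rw [h1, h2, Real.log_div ha.ne' (by positivity : 2 * π ≠ 0), Real.log_div ha.ne' pi_ne_zero,
    Real.log_div (by positivity) pi_ne_zero, Real.log_mul two_ne_zero ha.ne',
    Real.log_mul two_ne_zero pi_ne_zero]
  ring
end
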